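/- Projections of A-trees commute: Let A ⊆ ℕ be finite with #A ≥ 3 and let j, j' ∈ A be distinct. Then the projection π_{−j} maps 𝕋_A into 𝕋_{A∖{j}} (i.e. projecting away one label from a tree with no degenerate label yields a tree with no degenerate label), and for every T ∈ 𝕋_A one has π_{−j}(π_{−j'}(T)) = π_{−j'}(π_{−j}(T)). -/

import Mathlib

open scoped Classical

namespace AldousTrees

/-- The edges of a tree shape with label set `A`: the internal edges in `t` together with the
leaf edges `{a}`, `a ∈ A`. -/
def edges (A : Finset ℕ) (t : Finset (Finset ℕ)) : Finset (Finset ℕ) :=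
  t ∪ A.image fun a => ({a} : Finset ℕ)

/-- `C` is a child of `E`: a maximal proper member of `edges A t` contained in `E`. -/
def IsChild (A : Finset ℕ) (t : Finset (Finset ℕ)) (C E : Finset ℕ) : Prop :=
  C ∈ edges A t ∧ C ⊂ E ∧ ∀ F ∈ edges A t, C ⊂ F → ¬ F ⊂ E

/-- `t` is (the edge-set representation of) a tree shape with label set `A`: a rooted binary
combinatorial tree with leaves labelled by `A` and root of degree one.  `t` is the collection
of internal edges, each represented by the set of leaf labels above it. -/
structure IsTreeShape (A : Finset ℕ) (t : Finset (Finset ℕ)) : Prop where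
  nonempty_ground : A.Nonempty
  subset_ground : ∀ E ∈ t, E ⊆ A
  two_le_card : ∀ E ∈ t, 2 ≤ E.card
  ground_mem : 2 ≤ A.card → A ∈ t
  nested_or_disjoint : ∀ E ∈ edges A t, ∀ F ∈ edges A t, E ⊆ F ∨ F ⊆ E ∨ Disjoint E F
  binary : ∀ E ∈ t, ∃ C₁ C₂, IsChild A t C₁ E ∧ IsChild A t C₂ E ∧ C₁ ≠ C₂ ∧
    Disjoint C₁ C₂ ∧ C₁ ∪ C₂ = E ∧ ∀ C, IsChild A t C E → C = C₁ ∨ C = C₂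

/-- The number of children of the internal edge `E` that are leaf edges; an internal edge is of
type `d` if exactly `d` of its two children are leaf edges. -/
noncomputable def leafChildCount (A : Finset ℕ) (t : Finset (Finset ℕ)) (E : Finset ℕ) : ℕ :=
  ((A.image fun a => ({a} : Finset ℕ)).filter fun C => IsChild A t C E).card

end AldousTrees

namespace AldousTrees

open MeasureTheory Filter Set

noncomputable section

/-! ### Interval partitions -/

/-- An interval partition is recorded as a pair `(mass, blocks)`: a real mass `M` together
with the set of (endpoint pairs of) its open interval blocks. -/
abbrev IP : Type := ℝ × Set (ℝ × ℝ)

/-- The trivial (empty) interval partition. -/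
def IP.zero : IP := (0, ∅)

/-- `β` is an interval partition of `[0, β.1]`: its blocks are disjoint nonempty open
subintervals of `[0, β.1]` covering `[0, β.1]` up to a Lebesgue-null set. -/
def IsIntervalPartition (β : IP) : Prop :=
  0 ≤ β.1 ∧
  (∀ p ∈ β.2, 0 ≤ p.1 ∧ p.1 < p.2 ∧ p.2 ≤ β.1) ∧
  (β.2.Pairwise fun p q => Disjoint (Ioo p.1 p.2) (Ioo q.1 q.2)) ∧
  volume (Icc (0 : ℝ) β.1 \ ⋃ p ∈ β.2, Ioo p.1 p.2) = 0

/-- `𝒟_β(t) = d`: the ½-diversity of `β` up to the point `t` exists and equals `d`, i.e.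
`√π · √h · #{(a,b) ∈ β : b − a > h, b < t} → d` as `h ↓ 0`. -/
def HasDiversity (β : IP) (t d : ℝ) : Prop :=
  Tendsto
    (fun h : ℝ => Real.sqrt Real.pi * Real.sqrt h *
      ({p : ℝ × ℝ | p ∈ β.2 ∧ h < p.2 - p.1 ∧ p.2 < t}.ncard : ℝ))
    (nhdsWithin 0 (Ioi 0)) (nhds d)

/-- `𝒟_β(∞) = d`: the total ½-diversity of `β` exists and equals `d`. -/
def HasTotalDiversity (β : IP) (d : ℝ) : Prop :=
  Tendsto
    (fun h : ℝ => Real.sqrt Real.pi * Real.sqrt h *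
      ({p : ℝ × ℝ | p ∈ β.2 ∧ h < p.2 - p.1}.ncard : ℝ))
    (nhdsWithin 0 (Ioi 0)) (nhds d)

/-- `β ∈ 𝓘`: `β` is an interval partition with the ½-diversity property. -/
def MemIcal (β : IP) : Prop :=
  IsIntervalPartition β ∧ ∀ t : ℝ, 0 ≤ t → ∃ d, HasDiversity β t d

/-- Concatenation `α ⋆ β` of interval partitions. -/
def IP.concat (α β : IP) : IP :=
  (α.1 + β.1, α.2 ∪ (fun p : ℝ × ℝ => (α.1 + p.1, α.1 + p.2)) '' β.2)

/-- The interval partition `(0,x)` consisting of a single block of mass `x > 0`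
(empty if `x = 0`). -/
def IP.single (x : ℝ) : IP := (x, if 0 < x then {((0 : ℝ), x)} else ∅)

/-- The interval partition `β` scaled by `c`. -/
def IP.scale (c : ℝ) (β : IP) : IP :=
  (c * β.1, (fun p : ℝ × ℝ => (c * p.1, c * p.2)) '' β.2)

/-- The part of `β` strictly to the left of the block `(a,b)` (an interval partition of
`[0,a]`). -/
def IP.before (β : IP) (a : ℝ) : IP := (a, {p ∈ β.2 | p.2 ≤ a})

/-- The part of `β` strictly to the right of the block `(a,b)`, shifted to start at `0`. -/
def IP.after (β : IP) (b : ℝ) : IP :=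
  (β.1 - b, (fun p : ℝ × ℝ => (p.1 - b, p.2 - b)) '' {p ∈ β.2 | b ≤ p.1})

/-! ### A-trees -/

/-- An `A`-tree: a tree shape together with top masses on the leaves and interval partitions
on the internal edges.  `top` and `part` are total functions; membership in `𝕋_A` requires
them to vanish off the label set/shape. -/
structure ATree : Type where
  shape : Finset (Finset ℕ)
  top : ℕ → ℝ
  part : Finset ℕ → IP

/-- The parent edge `parent(E) = ⋂ {F ∈ t : E ⊊ F}` of `E` (computed inside the ground set
`⋃ t`; it equals `⋃ t` if no edge strictly contains `E`). -/
def parentEdge (t : Finset (Finset ℕ)) (E : Finset ℕ) : Finset ℕ :=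
  (t.sup id).filter fun x => ∀ F ∈ t, E ⊂ F → x ∈ F

/-- Label `i` is degenerate in `T`: `x_i + ‖β_{parent({i})}‖ = 0`. -/
def Degenerate (T : ATree) (i : ℕ) : Prop :=
  T.top i + (T.part (parentEdge T.shape {i})).1 = 0

/-- The basic requirements for `T` to be an `A`-tree: the shape is a tree shape on `A`, top
masses are nonnegative (and vanish off `A`), edge partitions lie in `𝓘` (and are trivial off
the shape), and `x_i + x_j > 0` for every type-2 edge `{i,j}`. -/
def PreTree (A : Finset ℕ) (T : ATree) : Prop :=
  IsTreeShape A T.shape ∧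
  (∀ i ∈ A, 0 ≤ T.top i) ∧ (∀ i, i ∉ A → T.top i = 0) ∧
  (∀ E ∈ T.shape, MemIcal (T.part E)) ∧ (∀ E, E ∉ T.shape → T.part E = IP.zero) ∧
  (∀ E ∈ T.shape, E.card = 2 → 0 < ∑ i ∈ E, T.top i)

/-- `T ∈ 𝕋_A`: an `A`-tree with no degenerate label. -/
def MemT (A : Finset ℕ) (T : ATree) : Prop :=
  PreTree A T ∧ ∀ i ∈ A, ¬ Degenerate T i

/-- `T ∈ 𝕋̃_A`: an `A`-tree with at most one degenerate label. -/
def MemTtilde (A : Finset ℕ) (T : ATree) : Prop :=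
  PreTree A T ∧ ∀ i ∈ A, ∀ i' ∈ A, Degenerate T i → Degenerate T i' → i = i'

/-- The projection `π_{−j}` removing label `j` from an `A`-tree.  If `parent({j})` is a
type-2 edge `{a,j}`, the whole compound is absorbed into the top mass of `a`; otherwise the
partitions of the sibling edge, the block `(0,x_j)` and the parent edge are concatenated onto
the sibling edge `parent({j}) ∖ {j}`; all other components are carried over along
`E ↦ E ∖ {j}`. -/
def proj (j : ℕ) (T : ATree) : ATree :=
  letI P := parentEdge T.shape {j}
  letI t' := (T.shape.erase P).image fun E => E.erase j
  { shape := t'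
    top := fun i =>
      if i = j then 0
      else if P.card = 2 ∧ i ∈ P then T.top i + T.top j + (T.part P).1
      else T.top i
    part := fun F =>
      if F ∈ t' then
        if P.card ≠ 2 ∧ F = P.erase j then
          IP.concat (IP.concat (T.part (P.erase j)) (IP.single (T.top j))) (T.part P)
        else if insert j F ∈ T.shape ∧ insert j F ≠ P then T.part (insert j F)
        else T.part F
      else IP.zero }

end

end AldousTrees

namespace AldousTrees

theorem mem_edges {A E : Finset ℕ} {t : Finset (Finset ℕ)} :
    E ∈ edges A t ↔ E ∈ t ∨ ∃ a ∈ A, {a} = E := by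
  simp [edges]

namespace IsTreeShape

variable {A : Finset ℕ} {t : Finset (Finset ℕ)}

theorem edge_nonempty (h : IsTreeShape A t) {E : Finset ℕ} (hE : E ∈ edges A t) :
    E.Nonempty := by
  rcases mem_edges.1 hE with hE | ⟨a, -, rfl⟩
  · exact Finset.card_pos.1 (by have := h.two_le_card E hE; omega)
  · simp

theorem edge_subset (h : IsTreeShape A t) {E : Finset ℕ} (hE : E ∈ edges A t) : E ⊆ A := by
  rcases mem_edges.1 hE with hE | ⟨a, ha, rfl⟩
  · exact h.subset_ground E hE
  · simpa using ha

/-- Binarity may be checked by splitting every internal edge into two disjoint edges. -/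
theorem of_split (hA : A.Nonempty) (hsub : ∀ E ∈ t, E ⊆ A) (hcard : ∀ E ∈ t, 2 ≤ E.card)
    (hground : 2 ≤ A.card → A ∈ t)
    (hlam : ∀ E ∈ edges A t, ∀ F ∈ edges A t, E ⊆ F ∨ F ⊆ E ∨ Disjoint E F)
    (hsplit : ∀ E ∈ t, ∃ C₁ ∈ edges A t, ∃ C₂ ∈ edges A t, Disjoint C₁ C₂ ∧ C₁ ∪ C₂ = E) :
    IsTreeShape A t := by
  refine ⟨hA, hsub, hcard, hground, hlam, fun E hE => ?_⟩
  have hne : ∀ C ∈ edges A t, C.Nonempty := by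
    intro C hC
    rcases mem_edges.1 hC with hC | ⟨a, -, rfl⟩
    · exact Finset.card_pos.1 (by have := hcard C hC; omega)
    · simp
  have key : ∀ C₁ ∈ edges A t, ∀ C₂ ∈ edges A t, Disjoint C₁ C₂ → C₁ ∪ C₂ = E →
      IsChild A t C₁ E := by
    intro C₁ h₁ C₂ h₂ hd hu
    obtain ⟨x, hx⟩ := hne C₁ h₁
    obtain ⟨y, hy⟩ := hne C₂ h₂
    rw [Finset.disjoint_left] at hd
    refine ⟨h₁, ?_, fun F hF h1F hFE => ?_⟩
    · rw [Finset.ssubset_iff_of_subset (hu ▸ Finset.subset_union_left)]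
      exact ⟨y, hu ▸ Finset.mem_union_right _ hy, fun h => hd h hy⟩
    · rcases hlam F hF C₂ h₂ with h | h | h
      · exact hd hx (h (h1F.subset hx))
      · exact hFE.not_subset (hu ▸ Finset.union_subset h1F.subset h)
      · rw [Finset.disjoint_left] at h
        refine h1F.not_subset fun z hz => ?_
        have := hu ▸ hFE.subset hz
        exact (Finset.mem_union.1 this).resolve_right (h hz)
  obtain ⟨C₁, h₁, C₂, h₂, hd, hu⟩ := hsplit E hE
  have k₁ := key C₁ h₁ C₂ h₂ hd hu
  have k₂ := key C₂ h₂ C₁ h₁ hd.symm (by rw [Finset.union_comm, hu])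
  refine ⟨C₁, C₂, k₁, k₂, ?_, hd, hu, ?_⟩
  · rintro rfl
    exact (hne C₁ h₁).ne_empty (by simpa using hd)
  · intro C hC
    have aux : ∀ D, IsChild A t D E → ∀ x ∈ C, x ∈ D → C = D := by
      intro D hD x hx hxD
      by_contra hne
      rcases hlam C hC.1 D hD.1 with h | h | h
      · exact hC.2.2 D hD.1 (h.ssubset_of_ne hne) hD.2.1
      · exact hD.2.2 C hC.1 (h.ssubset_of_ne (Ne.symm hne)) hC.2.1
      · exact Finset.disjoint_left.1 h hx hxD
    obtain ⟨x, hx⟩ := hne C hC.1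
    have : x ∈ C₁ ∪ C₂ := hu ▸ hC.2.1.subset hx
    rcases Finset.mem_union.1 this with hx' | hx'
    · exact Or.inl (aux C₁ k₁ x hx hx')
    · exact Or.inr (aux C₂ k₂ x hx hx')

/-- Every edge other than the root edge has a parent, from which its sibling is obtained by
removing its labels. -/
theorem exists_parent (h : IsTreeShape A t) {e : Finset ℕ} (he : e ∈ edges A t) (heA : e ≠ A) :
    ∃ Q ∈ t, e ⊂ Q ∧ Q \ e ∈ edges A t := by
  have heA' : e ⊂ A := (h.edge_subset he).ssubset_of_ne heA
  have hA : A ∈ t := h.ground_mem (by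
    have := Finset.card_lt_card heA'
    have := (h.edge_nonempty he).card_pos
    omega)
  obtain ⟨Q, hQ, hmin⟩ := Finset.exists_min_image (t.filter fun F => e ⊂ F) Finset.card
    ⟨A, by simp [hA, heA']⟩
  simp only [Finset.mem_filter] at hQ hmin
  refine ⟨Q, hQ.1, hQ.2, ?_⟩
  obtain ⟨C₁, C₂, k₁, k₂, -, hd, hu, -⟩ := h.binary Q hQ.1
  have aux : ∀ C, IsChild A t C Q → ∀ x ∈ e, x ∈ C → e = C := by
    intro C hC x hx hxC
    by_contra hne
    rcases h.nested_or_disjoint e he C hC.1 with h' | h' | h'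
    · have hss := h'.ssubset_of_ne hne
      have hCt : C ∈ t := by
        rcases mem_edges.1 hC.1 with hCt | ⟨a, -, rfl⟩
        · exact hCt
        · have := Finset.card_lt_card hss
          have := (h.edge_nonempty he).card_pos
          simp at this
          simp_all
      have := hmin C ⟨hCt, hss⟩
      have := Finset.card_lt_card hC.2.1
      omega
    · exact hC.2.2 e he (h'.ssubset_of_ne (Ne.symm hne)) hQ.2
    · exact Finset.disjoint_left.1 h' hx hxC
  obtain ⟨x, hx⟩ := h.edge_nonempty he
  have : x ∈ C₁ ∪ C₂ := hu ▸ hQ.2.subset hx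
  rcases Finset.mem_union.1 this with hx' | hx'
  · rw [aux C₁ k₁ x hx hx', ← hu, Finset.union_sdiff_cancel_left hd]
    exact k₂.1
  · rw [aux C₂ k₂ x hx hx', ← hu, Finset.union_sdiff_cancel_right hd]
    exact k₁.1

end IsTreeShape

/-- `P` is the internal edge whose children are the leaf edge `{j}` and `P ∖ {j}`. -/
structure IsLeafParent (A : Finset ℕ) (t : Finset (Finset ℕ)) (j : ℕ) (P : Finset ℕ) : Prop where
  mem : P ∈ t
  label_mem : j ∈ P
  sibling_mem : P.erase j ∈ edges A t

namespace IsTreeShape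

variable {A P : Finset ℕ} {t : Finset (Finset ℕ)} {j : ℕ}

theorem exists_isLeafParent (h : IsTreeShape A t) (hA : 2 ≤ A.card) (hj : j ∈ A) :
    ∃ P, IsLeafParent A t j P := by
  obtain ⟨P, hP, hjP, hs⟩ := h.exists_parent (e := {j}) (mem_edges.2 (Or.inr ⟨j, hj, rfl⟩))
    (by rintro rfl; simp at hA)
  exact ⟨P, hP, by simpa using hjP.subset, by rwa [← Finset.sdiff_singleton_eq_erase]⟩

theorem parent_subset (h : IsTreeShape A t) (hP : IsLeafParent A t j P) {F : Finset ℕ}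
    (hF : F ∈ t) (hjF : j ∈ F) : P ⊆ F := by
  have hF' : F ∈ edges A t := mem_edges.2 (Or.inl hF)
  rcases h.nested_or_disjoint F hF' _ hP.sibling_mem with h' | h' | h'
  · exact absurd (h' hjF) (by simp)
  · intro x hx
    by_cases hxj : x = j
    · exact hxj ▸ hjF
    · exact h' (Finset.mem_erase.2 ⟨hxj, hx⟩)
  · rcases h.nested_or_disjoint F hF' _ (mem_edges.2 (Or.inl hP.mem)) with h'' | h'' | h''
    · have hsub : F ⊆ {j} := by
        intro x hx
        by_contra hxj
        exact Finset.disjoint_left.1 h' hx (Finset.mem_erase.2 ⟨by simpa using hxj, h'' hx⟩)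
      have := Finset.card_le_card hsub
      have := h.two_le_card F hF
      simp at *
      omega
    · exact h''
    · exact absurd hP.label_mem (Finset.disjoint_left.1 h'' hjF)

theorem leafParent_unique (h : IsTreeShape A t) {P' : Finset ℕ} (hP : IsLeafParent A t j P)
    (hP' : IsLeafParent A t j P') : P = P' :=
  (h.parent_subset hP hP'.mem hP'.label_mem).antisymm
    (h.parent_subset hP' hP.mem hP.label_mem)

theorem parentEdge_eq (h : IsTreeShape A t) (hP : IsLeafParent A t j P) :
    parentEdge t {j} = P := by
  ext x
  simp only [parentEdge, Finset.mem_filter, Finset.mem_sup, id]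
  constructor
  · rintro ⟨-, hx⟩
    refine hx P hP.mem ((Finset.singleton_subset_iff.2 hP.label_mem).ssubset_of_ne ?_)
    rintro rfl
    simpa using h.two_le_card _ hP.mem
  · intro hx
    exact ⟨⟨P, hP.mem, hx⟩, fun F hF hjF =>
      h.parent_subset hP hF (Finset.singleton_subset_iff.1 hjF.subset) hx⟩

/-- Removing the label `j` identifies no two edges other than `P` and `P ∖ {j}`. -/
theorem erase_inj (h : IsTreeShape A t) (hP : IsLeafParent A t j P) {E F : Finset ℕ}
    (hE : E ∈ edges A t) (hF : F ∈ edges A t) (hEj : E ≠ {j}) (hFj : F ≠ {j})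
    (hEF : E.erase j = F.erase j) :
    E = F ∨ (E = P ∧ F = P.erase j) ∨ (F = P ∧ E = P.erase j) := by
  have key : ∀ E ∈ edges A t, ∀ F ∈ edges A t, F ≠ {j} → E.erase j = F.erase j →
      j ∉ E → j ∈ F → F = P ∧ E = P.erase j := by
    intro E hE F hF hFj hEF hjE hjF
    rw [Finset.erase_eq_of_notMem hjE] at hEF
    have hFt : F ∈ t := by
      rcases mem_edges.1 hF with hF | ⟨a, -, rfl⟩
      · exact hF
      · simp_all
    have hPF := h.parent_subset hP hFt hjF
    have hSE : P.erase j ⊆ E := hEF ▸ Finset.erase_subset_erase j hPF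
    have hES : E = P.erase j := by
      rcases h.nested_or_disjoint E hE P (mem_edges.2 (Or.inl hP.mem)) with h' | h' | h'
      · exact (Finset.subset_erase.2 ⟨h', hjE⟩).antisymm hSE
      · exact absurd (h' hP.label_mem) hjE
      · obtain ⟨x, hx⟩ := h.edge_nonempty hP.sibling_mem
        exact absurd (Finset.mem_of_mem_erase hx) (Finset.disjoint_left.1 h' (hSE hx))
    refine ⟨?_, hES⟩
    rw [← Finset.insert_erase hjF, ← hEF, hES, Finset.insert_erase hP.label_mem]
  by_cases hjE : j ∈ E <;> by_cases hjF : j ∈ F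
  · left
    rw [← Finset.insert_erase hjE, hEF, Finset.insert_erase hjF]
  · exact Or.inr (Or.inl (key F hF E hE hEj hEF.symm hjF hjE))
  · exact Or.inr (Or.inr (key E hE F hF hFj hEF hjE hjF))
  · left
    rwa [Finset.erase_eq_of_notMem hjE, Finset.erase_eq_of_notMem hjF] at hEF

end IsTreeShape

/-- The tree shape obtained from `t` by removing the label `j` with parent edge `P`. -/
def eraseShape (t : Finset (Finset ℕ)) (j : ℕ) (P : Finset ℕ) : Finset (Finset ℕ) :=
  (t.erase P).image fun E => E.erase j

theorem mem_eraseShape {t : Finset (Finset ℕ)} {j : ℕ} {P F : Finset ℕ} :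
    F ∈ eraseShape t j P ↔ ∃ E ∈ t, E ≠ P ∧ E.erase j = F := by
  simp only [eraseShape, Finset.mem_image, Finset.mem_erase]
  exact ⟨fun ⟨E, ⟨h1, h2⟩, h3⟩ => ⟨E, h2, h1, h3⟩, fun ⟨E, h1, h2, h3⟩ => ⟨E, ⟨h2, h1⟩, h3⟩⟩

namespace IsTreeShape

variable {A P : Finset ℕ} {t : Finset (Finset ℕ)} {j : ℕ}

theorem ne_singleton (h : IsTreeShape A t) {E : Finset ℕ} (hE : E ∈ t) (a : ℕ) : E ≠ {a} := by
  rintro rfl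
  simpa using h.two_le_card _ hE

theorem mem_edges_eraseShape (h : IsTreeShape A t) (hP : IsLeafParent A t j P) {F : Finset ℕ} :
    F ∈ edges (A.erase j) (eraseShape t j P) ↔ ∃ E ∈ edges A t, E ≠ {j} ∧ E.erase j = F := by
  rw [mem_edges, mem_eraseShape]
  constructor
  · rintro (⟨E, hE, -, rfl⟩ | ⟨a, ha, rfl⟩)
    · exact ⟨E, mem_edges.2 (Or.inl hE), h.ne_singleton hE j, rfl⟩
    · rw [Finset.mem_erase] at ha
      exact ⟨{a}, mem_edges.2 (Or.inr ⟨a, ha.2, rfl⟩), by simpa using ha.1,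
        Finset.erase_eq_of_notMem (by simpa using ha.1.symm)⟩
  · have key : ∀ E ∈ edges A t, E ≠ {j} → E ≠ P →
        (∃ E' ∈ t, E' ≠ P ∧ E'.erase j = E.erase j) ∨ ∃ a ∈ A.erase j, {a} = E.erase j := by
      intro E hE hEj hEP
      rcases mem_edges.1 hE with hEt | ⟨a, ha, rfl⟩
      · exact Or.inl ⟨E, hEt, hEP, rfl⟩
      · have haj : a ≠ j := by simpa using hEj
        exact Or.inr ⟨a, Finset.mem_erase.2 ⟨haj, ha⟩,
          (Finset.erase_eq_of_notMem (by simpa using haj.symm)).symm⟩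
    rintro ⟨E, hE, hEj, rfl⟩
    by_cases hEP : E = P
    · subst hEP
      have := key _ hP.sibling_mem
        (fun h => by have : j ∈ E.erase j := h ▸ Finset.mem_singleton_self j
                     simp at this)
        (fun h => by have : j ∈ E.erase j := h.symm ▸ hP.label_mem
                     simp at this)
      rwa [Finset.erase_idem] at this
    · exact key E hE hEj hEP

theorem eraseShape_isTreeShape (h : IsTreeShape A t) (hP : IsLeafParent A t j P) :
    IsTreeShape (A.erase j) (eraseShape t j P) := by
  have hPA := h.subset_ground P hP.mem
  have hP2 := h.two_le_card P hP.mem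
  refine of_split ?_ ?_ ?_ ?_ ?_ ?_
  · exact (h.edge_nonempty hP.sibling_mem).mono (Finset.erase_subset_erase j hPA)
  · intro F hF
    obtain ⟨E, hE, -, rfl⟩ := mem_eraseShape.1 hF
    exact Finset.erase_subset_erase j (h.subset_ground E hE)
  · intro F hF
    obtain ⟨E, hE, hEP, rfl⟩ := mem_eraseShape.1 hF
    by_cases hjE : j ∈ E
    · have := Finset.card_lt_card ((h.parent_subset hP hE hjE).ssubset_of_ne hEP.symm)
      rw [Finset.card_erase_of_mem hjE]
      omega
    · rw [Finset.erase_eq_of_notMem hjE]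
      exact h.two_le_card E hE
  · intro hcard
    rw [Finset.card_erase_of_mem (hPA hP.label_mem)] at hcard
    have hAt : A ∈ t := h.ground_mem (by omega)
    by_cases hAP : A = P
    · subst hAP
      refine mem_eraseShape.2 ⟨A.erase j, ?_, ?_, Finset.erase_idem⟩
      · rcases mem_edges.1 hP.sibling_mem with h' | ⟨a, -, ha⟩
        · exact h'
        · have := congrArg Finset.card ha
          rw [Finset.card_erase_of_mem hP.label_mem] at this
          simp at this
          omega
      · exact (Finset.erase_ssubset hP.label_mem).ne
    · exact mem_eraseShape.2 ⟨A, hAt, hAP, rfl⟩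
  · intro E' hE' F' hF'
    obtain ⟨E, hE, -, rfl⟩ := (h.mem_edges_eraseShape hP).1 hE'
    obtain ⟨F, hF, -, rfl⟩ := (h.mem_edges_eraseShape hP).1 hF'
    rcases h.nested_or_disjoint E hE F hF with h' | h' | h'
    · exact Or.inl (Finset.erase_subset_erase j h')
    · exact Or.inr (Or.inl (Finset.erase_subset_erase j h'))
    · exact Or.inr (Or.inr (h'.mono (Finset.erase_subset _ _) (Finset.erase_subset _ _)))
  · intro F hF
    obtain ⟨E, hE, hEP, rfl⟩ := mem_eraseShape.1 hF
    obtain ⟨C₁, C₂, k₁, k₂, -, hd, hu, -⟩ := h.binary E hE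
    have aux : ∀ C D, D ∈ edges A t → Disjoint C D → C ∪ D = E → C ≠ {j} := by
      rintro C D hD hd hu rfl
      refine hEP (h.leafParent_unique ⟨hE, ?_, ?_⟩ hP)
      · rw [← hu]; simp
      · rwa [← Finset.sdiff_singleton_eq_erase, ← hu, Finset.union_sdiff_cancel_left hd]
    refine ⟨C₁.erase j, (h.mem_edges_eraseShape hP).2 ⟨C₁, k₁.1, aux C₁ C₂ k₂.1 hd hu, rfl⟩,
      C₂.erase j, (h.mem_edges_eraseShape hP).2 ⟨C₂, k₂.1, aux C₂ C₁ k₁.1 hd.symm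
        (by rw [Finset.union_comm, hu]), rfl⟩,
      hd.mono (Finset.erase_subset _ _) (Finset.erase_subset _ _), ?_⟩
    rw [← hu, Finset.erase_union_distrib]

/-- An edge `Q ≠ P` containing `j'` becomes the parent edge of `j'` after the removal of `j` if
`Q ∖ {j', j}` is the image of an edge. -/
theorem isLeafParent_eraseShape (h : IsTreeShape A t) (hP : IsLeafParent A t j P) {j' : ℕ}
    {Q : Finset ℕ} (hQ : Q ∈ t) (hQP : Q ≠ P) (hj' : j' ∈ Q) (hne : j' ≠ j)
    (hs : ∃ S ∈ edges A t, S ≠ {j} ∧ S.erase j = (Q.erase j').erase j) :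
    IsLeafParent (A.erase j) (eraseShape t j P) j' (Q.erase j) := by
  refine ⟨mem_eraseShape.2 ⟨Q, hQ, hQP, rfl⟩, Finset.mem_erase.2 ⟨hne, hj'⟩, ?_⟩
  rw [Finset.erase_right_comm, h.mem_edges_eraseShape hP]
  exact hs

end IsTreeShape

open MeasureTheory Filter Set

namespace IP

theorem concat_assoc (α β γ : IP) : (α.concat β).concat γ = α.concat (β.concat γ) := by
  refine Prod.ext (add_assoc _ _ _) ?_
  simp only [concat, image_union, image_image, union_assoc, add_assoc]

@[simp] theorem concat_fst (α β : IP) : (α.concat β).1 = α.1 + β.1 := rfl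

@[simp] theorem single_fst (x : ℝ) : (single x).1 = x := rfl

end IP

theorem mem_concat {α β : IP} {p : ℝ × ℝ} :
    p ∈ (α.concat β).2 ↔ p ∈ α.2 ∨ (p.1 - α.1, p.2 - α.1) ∈ β.2 := by
  simp only [IP.concat, mem_union, mem_image]
  refine or_congr Iff.rfl ⟨?_, fun h => ⟨_, h, by simp⟩⟩
  rintro ⟨q, hq, rfl⟩
  simpa using hq

theorem IsIntervalPartition.concat {α β : IP} (hα : IsIntervalPartition α)
    (hβ : IsIntervalPartition β) : IsIntervalPartition (α.concat β) := by
  obtain ⟨a0, a1, a2, a3⟩ := hα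
  obtain ⟨b0, b1, b2, b3⟩ := hβ
  refine ⟨add_nonneg a0 b0, ?_, ?_, ?_⟩
  · intro p hp
    rw [IP.concat_fst]
    rcases mem_concat.1 hp with h | h
    · obtain ⟨h1, h2, h3⟩ := a1 p h
      exact ⟨h1, h2, by linarith⟩
    · obtain ⟨h1, h2, h3⟩ := b1 _ h
      dsimp only at h1 h2 h3
      exact ⟨by linarith, by linarith, by linarith⟩
  · have cross : ∀ p q : ℝ × ℝ, p ∈ α.2 → (q.1 - α.1, q.2 - α.1) ∈ β.2 →
        Disjoint (Ioo p.1 p.2) (Ioo q.1 q.2) := by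
      intro p q hp hq
      rw [Set.disjoint_left]
      rintro x ⟨-, hx⟩ ⟨hx', -⟩
      have h1 := (a1 p hp).2.2
      have h2 := (b1 _ hq).1
      dsimp only at h2
      linarith
    intro p hp q hq hpq
    rcases mem_concat.1 hp with h | h <;> rcases mem_concat.1 hq with h' | h'
    · exact a2 h h' hpq
    · exact cross p q h h'
    · exact (cross q p h' h).symm
    · have hd := b2 h h' (fun he => hpq (by
        simp only [Prod.mk.injEq, sub_left_inj] at he
        exact Prod.ext he.1 he.2))
      change Disjoint (Ioo _ _) (Ioo _ _) at hd
      rw [Set.disjoint_left] at hd ⊢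
      rintro x ⟨hx1, hx2⟩ ⟨hx3, hx4⟩
      exact hd (a := x - α.1) ⟨by simpa using hx1, by simpa using hx2⟩
        ⟨by simpa using hx3, by simpa using hx4⟩
  · refine measure_mono_null (t := (Icc (0 : ℝ) α.1 \ ⋃ p ∈ α.2, Ioo p.1 p.2) ∪
      (fun x => -α.1 + x) ⁻¹' (Icc (0 : ℝ) β.1 \ ⋃ p ∈ β.2, Ioo p.1 p.2)) ?_
      (measure_union_null a3 (by rw [measure_preimage_add]; exact b3))
    rintro x ⟨⟨hx0, hx1⟩, hx⟩
    rw [IP.concat_fst] at hx1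
    simp only [mem_iUnion, not_exists] at hx
    rcases le_or_gt x α.1 with hxa | hxa
    · refine Or.inl ⟨⟨hx0, hxa⟩, ?_⟩
      simp only [mem_iUnion, not_exists]
      exact fun p hp => hx p (mem_concat.2 (Or.inl hp))
    · refine Or.inr ⟨⟨by linarith, by linarith⟩, ?_⟩
      simp only [mem_iUnion, not_exists]
      rintro p hp ⟨h1, h2⟩
      exact hx (α.1 + p.1, α.1 + p.2) (mem_concat.2 (Or.inr (by simpa using hp)))
        ⟨by dsimp only; linarith, by dsimp only; linarith⟩

theorem IsIntervalPartition.single {x : ℝ} (hx : 0 ≤ x) :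
    IsIntervalPartition (IP.single x) := by
  rcases hx.eq_or_lt with rfl | hx
  · simp [IsIntervalPartition, IP.single]
  · refine ⟨hx.le, ?_, ?_, ?_⟩ <;> simp [IP.single, hx]
    refine measure_mono_null (t := {0, x}) ?_ ((Set.toFinite _).measure_zero _)
    rintro y ⟨⟨h1, h2⟩, h3⟩
    rw [mem_Ioo, not_and, not_lt] at h3
    rcases h1.eq_or_lt with h | h
    · exact Or.inl h.symm
    · exact Or.inr (h2.antisymm (h3 h))

/-- An interval partition has only finitely many blocks of length more than `h > 0`. -/
theorem IsIntervalPartition.finite_blocks {β : IP} (hβ : IsIntervalPartition β) {h : ℝ}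
    (hh : 0 < h) : {p : ℝ × ℝ | p ∈ β.2 ∧ h < p.2 - p.1}.Finite := by
  obtain ⟨b0, b1, b2, -⟩ := hβ
  have := Measure.finite_const_le_meas_of_disjoint_iUnion (volume : Measure ℝ)
    (ι := β.2) (ε := ENNReal.ofReal h) (by simpa using hh)
    (As := fun p => Ioo p.1.1 p.1.2) (fun p => measurableSet_Ioo)
    (fun p q hpq => b2 p.2 q.2 (fun h => hpq (Subtype.ext h)))
    (ne_top_of_le_ne_top (b := volume (Icc (0 : ℝ) β.1)) (by simp) (measure_mono (by
      simp only [iUnion_subset_iff, Subtype.forall]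
      intro p hp x hx
      obtain ⟨h1, h2, h3⟩ := b1 p hp
      exact ⟨h1.trans hx.1.le, hx.2.le.trans h3⟩)))
  refine (this.image Subtype.val).subset ?_
  rintro p ⟨hp, hlt⟩
  refine ⟨⟨p, hp⟩, ?_, rfl⟩
  simpa using ENNReal.ofReal_le_ofReal hlt.le

theorem MemIcal.concat {α β : IP} (hα : MemIcal α) (hβ : MemIcal β) :
    MemIcal (α.concat β) := by
  refine ⟨hα.1.concat hβ.1, fun t ht => ?_⟩
  have hsplit : ∀ h : ℝ, 0 < h →
      {p : ℝ × ℝ | p ∈ (α.concat β).2 ∧ h < p.2 - p.1 ∧ p.2 < t}.ncard =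
        {p : ℝ × ℝ | p ∈ α.2 ∧ h < p.2 - p.1 ∧ p.2 < t}.ncard +
        {p : ℝ × ℝ | p ∈ β.2 ∧ h < p.2 - p.1 ∧ p.2 < t - α.1}.ncard := by
    intro h hh
    have hinj : Function.Injective fun p : ℝ × ℝ => (α.1 + p.1, α.1 + p.2) := by
      intro p q hpq
      simp only [Prod.mk.injEq, add_right_inj] at hpq
      exact Prod.ext hpq.1 hpq.2
    rw [← ncard_image_of_injective
      {p : ℝ × ℝ | p ∈ β.2 ∧ h < p.2 - p.1 ∧ p.2 < t - α.1} hinj, ← ncard_union_eq ?_ ?_ ?_]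
    · congr 1
      ext p
      simp only [mem_ofPred_eq, mem_union, mem_image, mem_concat]
      constructor
      · rintro ⟨hp | hp, h1, h2⟩
        · exact Or.inl ⟨hp, h1, h2⟩
        · exact Or.inr ⟨_, ⟨hp, by simpa using h1, by simpa using h2⟩, by simp⟩
      · rintro (⟨hp, h1, h2⟩ | ⟨q, ⟨hq, h1, h2⟩, rfl⟩)
        · exact ⟨Or.inl hp, h1, h2⟩
        · exact ⟨Or.inr (by simpa using hq), by simpa using h1, by dsimp only; linarith⟩
    · rw [Set.disjoint_left]
      rintro _ ⟨hp, -, -⟩ ⟨q, ⟨hq, -, -⟩, rfl⟩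
      have h1 := hα.1.2.1 _ hp
      have h2 := hβ.1.2.1 q hq
      dsimp only at h1
      linarith
    · exact (hα.1.finite_blocks hh).subset fun p hp => ⟨hp.1, hp.2.1⟩
    · exact ((hβ.1.finite_blocks hh).subset fun p hp => ⟨hp.1, hp.2.1⟩).image _
  obtain ⟨d₁, hd₁⟩ := hα.2 t ht
  have hβt : ∃ d, HasDiversity β (t - α.1) d := by
    rcases le_or_gt 0 (t - α.1) with h | h
    · exact hβ.2 _ h
    · refine ⟨0, ?_⟩
      have hempty : ∀ h' : ℝ,
          {p : ℝ × ℝ | p ∈ β.2 ∧ h' < p.2 - p.1 ∧ p.2 < t - α.1} = ∅ := by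
        intro h'
        ext p
        simp only [mem_ofPred_eq, mem_empty_iff_false, iff_false]
        rintro ⟨hp, -, hp'⟩
        obtain ⟨h1, h2, -⟩ := hβ.1.2.1 p hp
        linarith
      simp [HasDiversity, hempty]
  obtain ⟨d₂, hd₂⟩ := hβt
  refine ⟨d₁ + d₂, (hd₁.add hd₂).congr' ?_⟩
  filter_upwards [self_mem_nhdsWithin] with h hh
  rw [hsplit h hh]
  push_cast
  ring

theorem MemIcal.single {x : ℝ} (hx : 0 ≤ x) : MemIcal (IP.single x) := by
  refine ⟨IsIntervalPartition.single hx, fun t _ => ⟨0, ?_⟩⟩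
  have hle : ∀ h : ℝ,
      ({p : ℝ × ℝ | p ∈ (IP.single x).2 ∧ h < p.2 - p.1 ∧ p.2 < t}.ncard : ℝ) ≤ 1 := by
    intro h
    have : {p : ℝ × ℝ | p ∈ (IP.single x).2 ∧ h < p.2 - p.1 ∧ p.2 < t} ⊆ {((0 : ℝ), x)} := by
      rintro p ⟨hp, -⟩
      simp only [IP.single] at hp
      split_ifs at hp
      · exact hp
      · exact hp.elim
    exact_mod_cast (ncard_le_ncard this).trans (ncard_singleton _).le
  have hlim : Tendsto (fun h : ℝ => Real.sqrt Real.pi * Real.sqrt h)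
      (nhdsWithin 0 (Ioi 0)) (nhds 0) := by
    have : Continuous fun h : ℝ => Real.sqrt Real.pi * Real.sqrt h := by fun_prop
    simpa using (this.tendsto 0).mono_left nhdsWithin_le_nhds
  exact squeeze_zero (fun h => by positivity)
    (fun h => mul_le_of_le_one_right (by positivity) (hle h)) hlim

section projection

variable {A P : Finset ℕ} {T : ATree} {j : ℕ}

theorem proj_shape (h : IsTreeShape A T.shape) (hP : IsLeafParent A T.shape j P) :
    (proj j T).shape = eraseShape T.shape j P := by
  simp only [proj, h.parentEdge_eq hP, eraseShape]

theorem proj_top (h : IsTreeShape A T.shape) (hP : IsLeafParent A T.shape j P) (i : ℕ) :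
    (proj j T).top i = if i = j then 0 else
      if P.erase j = {i} then T.top i + T.top j + (T.part P).1 else T.top i := by
  simp only [proj, h.parentEdge_eq hP]
  by_cases hij : i = j
  · simp [hij]
  · have hiff : (P.card = 2 ∧ i ∈ P) ↔ P.erase j = {i} := by
      constructor
      · rintro ⟨hc, hi⟩
        refine (Finset.eq_of_subset_of_card_le (by simp [hij, hi]) ?_).symm
        rw [Finset.card_erase_of_mem hP.label_mem, hc, Finset.card_singleton]
      · intro he
        refine ⟨?_, Finset.mem_of_mem_erase (he ▸ Finset.mem_singleton_self i)⟩
        rw [← Finset.card_erase_add_one hP.label_mem, he, Finset.card_singleton]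
    simp only [hij, if_false, hiff]

theorem proj_part (h : IsTreeShape A T.shape) (hP : IsLeafParent A T.shape j P)
    {E : Finset ℕ} (hE : E ∈ T.shape) (hEP : E ≠ P) :
    (proj j T).part (E.erase j) = if E = P.erase j then
      ((T.part E).concat (IP.single (T.top j))).concat (T.part P) else T.part E := by
  have hmem : E.erase j ∈ (T.shape.erase P).image fun E => E.erase j :=
    mem_eraseShape.2 ⟨E, hE, hEP, rfl⟩
  have hE' : E ∈ edges A T.shape := mem_edges.2 (Or.inl hE)
  have hiff : (P.card ≠ 2 ∧ E.erase j = P.erase j) ↔ E = P.erase j := by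
    constructor
    · rintro ⟨-, he⟩
      rcases h.erase_inj hP hE' (mem_edges.2 (Or.inl hP.mem)) (h.ne_singleton hE j)
        (h.ne_singleton hP.mem j) he with h' | h' | h'
      · exact absurd h' hEP
      · exact absurd h'.1 hEP
      · exact h'.2
    · intro he
      refine ⟨fun hc => ?_, by rw [he, Finset.erase_idem]⟩
      have := h.two_le_card E hE
      rw [he, Finset.card_erase_of_mem hP.label_mem] at this
      omega
  simp only [proj, h.parentEdge_eq hP, hmem, hiff, if_true]
  by_cases hES : E = P.erase j
  · simp [hES]
  · simp only [hES, if_false]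
    by_cases hjE : j ∈ E
    · simp [Finset.insert_erase hjE, hE, hEP]
    · rw [Finset.erase_eq_of_notMem hjE, if_neg]
      rintro ⟨hi, hiP⟩
      rcases h.erase_inj hP hE' (mem_edges.2 (Or.inl hi)) (h.ne_singleton hE j)
        (h.ne_singleton hi j) (by simp [hjE]) with h' | h' | h'
      · exact hjE (h' ▸ Finset.mem_insert_self j E)
      · exact hEP h'.1
      · exact hiP h'.1

theorem proj_part_of_notMem {F : Finset ℕ} (hF : F ∉ (proj j T).shape) :
    (proj j T).part F = IP.zero :=
  if_neg hF

theorem proj_isTreeShape (h : IsTreeShape A T.shape) (hP : IsLeafParent A T.shape j P) :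
    IsTreeShape (A.erase j) (proj j T).shape := by
  rw [proj_shape h hP]
  exact h.eraseShape_isTreeShape hP

namespace IsTreeShape

variable {t : Finset (Finset ℕ)} {i : ℕ}

theorem erase_eq_singleton (h : IsTreeShape A t) (hP : IsLeafParent A t j P)
    (hPi : IsLeafParent A t i P) (hij : i ≠ j) : P.erase j = {i} := by
  have hi : i ∈ P.erase j := Finset.mem_erase.2 ⟨hij, hPi.label_mem⟩
  rcases mem_edges.1 hP.sibling_mem with h' | ⟨a, -, ha⟩
  · exact absurd (h.parent_subset hPi h' hi hP.label_mem) (by simp)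
  · rw [← ha] at hi ⊢
    rw [Finset.mem_singleton.1 hi]

theorem erase_ne_singleton (h : IsTreeShape A t) (hP : IsLeafParent A t j P) {Q : Finset ℕ}
    (hQ : IsLeafParent A t i Q) (hij : i ≠ j) (hne : Q ≠ P) : Q.erase i ≠ {j} := by
  intro he
  have hjQ : j ∈ Q := Finset.mem_of_mem_erase (he ▸ Finset.mem_singleton_self j)
  refine hne (h.leafParent_unique ⟨hQ.mem, hjQ, ?_⟩ hP)
  rw [← Finset.insert_erase hQ.label_mem, he]
  refine mem_edges.2 (Or.inr ⟨i, h.subset_ground Q hQ.mem hQ.label_mem, ?_⟩)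
  ext x
  simp only [Finset.mem_singleton, Finset.mem_erase, Finset.mem_insert]
  grind

theorem isLeafParent_eraseShape_of_ne (h : IsTreeShape A t) (hP : IsLeafParent A t j P)
    {Q : Finset ℕ} (hQ : IsLeafParent A t i Q) (hij : i ≠ j) (hne : Q ≠ P) :
    IsLeafParent (A.erase j) (eraseShape t j P) i (Q.erase j) :=
  h.isLeafParent_eraseShape hP hQ.mem hne hQ.label_mem hij
    ⟨_, hQ.sibling_mem, h.erase_ne_singleton hP hQ hij hne, rfl⟩

end IsTreeShape

theorem PreTree.mass_nonneg (hT : PreTree A T) (F : Finset ℕ) : 0 ≤ (T.part F).1 := by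
  obtain ⟨-, -, -, hI, hz, -⟩ := hT
  by_cases hF : F ∈ T.shape
  · exact (hI F hF).1.1
  · rw [hz F hF]
    exact le_rfl

theorem PreTree.le_proj_top (hT : PreTree A T) (hP : IsLeafParent A T.shape j P) {i : ℕ}
    (hij : i ≠ j) : T.top i ≤ (proj j T).top i := by
  have h0 := hT.2.1 j (hT.1.subset_ground P hP.mem hP.label_mem)
  have hm := hT.mass_nonneg P
  rw [proj_top hT.1 hP, if_neg hij]
  split_ifs <;> linarith

theorem PreTree.proj_top_pos (hT : PreTree A T) (hP : IsLeafParent A T.shape j P) {i : ℕ}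
    (hPi : P.erase j = {i}) : 0 < (proj j T).top i := by
  have hij : i ≠ j := Finset.ne_of_mem_erase (hPi ▸ Finset.mem_singleton_self i)
  have hm := hT.mass_nonneg P
  have hpos := hT.2.2.2.2.2 P hP.mem
    (by rw [← Finset.card_erase_add_one hP.label_mem, hPi, Finset.card_singleton])
  rw [← Finset.sum_erase_add _ _ hP.label_mem, hPi, Finset.sum_singleton] at hpos
  rw [proj_top hT.1 hP, if_neg hij, if_pos hPi]
  linarith

theorem PreTree.proj (hT : PreTree A T) (hP : IsLeafParent A T.shape j P) :
    PreTree (A.erase j) (proj j T) := by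
  have hT' := hT
  obtain ⟨h, h0, hz, hI, -, h2⟩ := hT
  have htop : ∀ i ∈ A.erase j, 0 ≤ (AldousTrees.proj j T).top i := fun i hi =>
    (h0 i (Finset.mem_of_mem_erase hi)).trans
      (hT'.le_proj_top hP (Finset.ne_of_mem_erase hi))
  refine ⟨proj_isTreeShape h hP, htop, ?_, ?_, fun F hF => proj_part_of_notMem hF, ?_⟩
  · intro i hi
    rw [proj_top h hP]
    split_ifs with hij hPi
    · rfl
    · exact absurd (Finset.mem_erase.2 ⟨hij, h.edge_subset hP.sibling_mem (by simp [hPi])⟩) hi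
    · exact hz i fun hiA => hi (Finset.mem_erase.2 ⟨hij, hiA⟩)
  · intro F hF
    rw [proj_shape h hP, mem_eraseShape] at hF
    obtain ⟨E, hE, hEP, rfl⟩ := hF
    rw [proj_part h hP hE hEP]
    split_ifs
    · exact ((hI E hE).concat (MemIcal.single
        (h0 j (h.subset_ground P hP.mem hP.label_mem)))).concat (hI P hP.mem)
    · exact hI E hE
  · intro F hF hc
    have hFA := (proj_isTreeShape h hP).subset_ground F hF
    rw [proj_shape h hP, mem_eraseShape] at hF
    obtain ⟨E, hE, hEP, rfl⟩ := hF
    by_cases hjE : j ∈ E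
    · have hPE := h.parent_subset hP hE hjE
      have hlt := Finset.card_lt_card (hPE.ssubset_of_ne hEP.symm)
      rw [Finset.card_erase_of_mem hjE] at hc
      have hP2 := h.two_le_card P hP.mem
      obtain ⟨a, ha⟩ := Finset.card_eq_one.1
        (show (P.erase j).card = 1 by rw [Finset.card_erase_of_mem hP.label_mem]; omega)
      refine Finset.sum_pos' (fun i hi => htop i (hFA hi))
        ⟨a, Finset.erase_subset_erase j hPE (by simp [ha]), hT'.proj_top_pos hP ha⟩
    · rw [Finset.erase_eq_of_notMem hjE] at hc ⊢
      exact (h2 E hE hc).trans_le (Finset.sum_le_sum fun i hi =>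
        hT'.le_proj_top hP (by rintro rfl; exact hjE hi))

/-- The projection removing a label preserves the absence of degenerate labels. -/
theorem MemT.proj (hA : 2 ≤ A.card) (hj : j ∈ A) (hT : MemT A T) :
    MemT (A.erase j) (proj j T) := by
  obtain ⟨hT, hdeg⟩ := hT
  have h := hT.1
  obtain ⟨P, hP⟩ := h.exists_isLeafParent hA hj
  have hT1 := hT.proj hP
  refine ⟨hT1, fun i hi => ?_⟩
  obtain ⟨hij, hiA⟩ := Finset.mem_erase.1 hi
  obtain ⟨Q, hQ⟩ := h.exists_isLeafParent hA hiA
  unfold Degenerate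
  by_cases hQP : Q = P
  · subst hQP
    have := hT.proj_top_pos hP (h.erase_eq_singleton hP hQ hij)
    have := hT1.mass_nonneg (parentEdge (AldousTrees.proj j T).shape {i})
    linarith
  · have hQ1 := h.isLeafParent_eraseShape_of_ne hP hQ hij hQP
    have hi0 := hdeg i hiA
    rw [Degenerate, h.parentEdge_eq hQ] at hi0
    rw [proj_shape h hP, (h.eraseShape_isTreeShape hP).parentEdge_eq hQ1,
      proj_part h hP hQ.mem hQP]
    have h1 := hT.le_proj_top hP hij
    have h2 := hT.2.1 i hiA
    have h3 := hT.mass_nonneg Q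
    have h4 := hT.mass_nonneg P
    have h5 := hT.2.1 j hj
    have h6 : 0 < T.top i + (T.part Q).1 := lt_of_le_of_ne (add_nonneg h2 h3) (Ne.symm hi0)
    split_ifs
    · simp only [IP.concat_fst, IP.single_fst]
      linarith
    · linarith

end projection

section commutation

variable {A P P' : Finset ℕ} {T : ATree} {j j' : ℕ}

theorem erase_eq_erase_iff_of_ne {t : Finset (Finset ℕ)} (h : IsTreeShape A t)
    (hP : IsLeafParent A t j P) (hP' : IsLeafParent A t j' P') (hjj' : j ≠ j') (hne : P ≠ P')
    {e : Finset ℕ} (he : e ∈ edges A t) (hej : e ≠ {j}) (heP : e ≠ P) :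
    e.erase j = (P'.erase j).erase j' ↔
      e = P'.erase j' ∨ (P'.erase j' = P ∧ e = P.erase j) := by
  rw [Finset.erase_right_comm]
  constructor
  · intro heq
    rcases h.erase_inj hP he hP'.sibling_mem hej
      (h.erase_ne_singleton hP hP' hjj'.symm hne.symm) heq with h' | h' | h'
    · exact Or.inl h'
    · exact absurd h'.1 heP
    · exact Or.inr h'
  · rintro (rfl | ⟨h1, rfl⟩)
    · rfl
    · rw [h1, Finset.erase_idem]

theorem isLeafParent_proj_of_ne (h : IsTreeShape A T.shape)
    (hP : IsLeafParent A T.shape j P) (hP' : IsLeafParent A T.shape j' P') (hjj' : j ≠ j')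
    (hne : P ≠ P') : IsLeafParent (A.erase j) (proj j T).shape j' (P'.erase j) := by
  rw [proj_shape h hP]
  exact h.isLeafParent_eraseShape_of_ne hP hP' hjj'.symm hne.symm

theorem erase_ne_erase {t : Finset (Finset ℕ)} (h : IsTreeShape A t)
    (hP : IsLeafParent A t j P) {E Q : Finset ℕ} (hE : E ∈ t) (hQ : Q ∈ t)
    (hEP : E ≠ P) (hQP : Q ≠ P) (hEQ : E ≠ Q) : E.erase j ≠ Q.erase j := by
  intro heq
  rcases h.erase_inj hP (mem_edges.2 (Or.inl hE)) (mem_edges.2 (Or.inl hQ))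
    (h.ne_singleton hE j) (h.ne_singleton hQ j) heq with h' | h' | h'
  · exact hEQ h'
  · exact hEP h'.1
  · exact hQP h'.1

theorem mem_proj_proj_shape (h : IsTreeShape A T.shape) (hP : IsLeafParent A T.shape j P)
    {Q : Finset ℕ} (hQ : Q ∈ T.shape) (hQP : Q ≠ P)
    (hP1 : IsLeafParent (A.erase j) (proj j T).shape j' (Q.erase j)) {F : Finset ℕ} :
    F ∈ (proj j' (proj j T)).shape ↔
      ∃ E ∈ T.shape, E ≠ P ∧ E ≠ Q ∧ (E.erase j).erase j' = F := by
  rw [proj_shape (proj_isTreeShape h hP) hP1, mem_eraseShape, proj_shape h hP]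
  simp only [mem_eraseShape]
  constructor
  · rintro ⟨_, ⟨E, hE, hEP, rfl⟩, hne, rfl⟩
    exact ⟨E, hE, hEP, fun h => hne (h ▸ rfl), rfl⟩
  · rintro ⟨E, hE, hEP, hEQ, rfl⟩
    exact ⟨_, ⟨E, hE, hEP, rfl⟩, erase_ne_erase h hP hE hQ hEP hQP hEQ, rfl⟩

theorem mem_proj_shape (h : IsTreeShape A T.shape) (hP : IsLeafParent A T.shape j P)
    {E : Finset ℕ} (hE : E ∈ T.shape) (hEP : E ≠ P) : E.erase j ∈ (proj j T).shape := by
  rw [proj_shape h hP]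
  exact mem_eraseShape.2 ⟨E, hE, hEP, rfl⟩

theorem proj_proj_part_of_ne (h : IsTreeShape A T.shape) (hP : IsLeafParent A T.shape j P)
    (hP' : IsLeafParent A T.shape j' P') (hjj' : j ≠ j') (hne : P ≠ P')
    {E : Finset ℕ} (hE : E ∈ T.shape) (hEP : E ≠ P) (hEP' : E ≠ P') :
    (proj j' (proj j T)).part ((E.erase j).erase j') =
      if E = P'.erase j' ∨ (P'.erase j' = P ∧ E = P.erase j) then
        ((if E = P.erase j then ((T.part E).concat (IP.single (T.top j))).concat (T.part P)
          else T.part E).concat (IP.single (T.top j'))).concat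
        (if P' = P.erase j then ((T.part P').concat (IP.single (T.top j))).concat (T.part P)
          else T.part P')
      else if E = P.erase j then ((T.part E).concat (IP.single (T.top j))).concat (T.part P)
        else T.part E := by
  have htop : (proj j T).top j' = T.top j' := by
    rw [proj_top h hP, if_neg hjj'.symm, if_neg]
    exact h.erase_ne_singleton hP' hP hjj' hne
  rw [proj_part (proj_isTreeShape h hP) (isLeafParent_proj_of_ne h hP hP' hjj' hne)
    (mem_proj_shape h hP hE hEP) (erase_ne_erase h hP hE hP'.mem hEP hne.symm hEP'),
    proj_part h hP hE hEP, proj_part h hP hP'.mem hne.symm, htop]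
  simp only [erase_eq_erase_iff_of_ne h hP hP' hjj' hne (mem_edges.2 (Or.inl hE))
    (h.ne_singleton hE j) hEP]

theorem proj_proj_top_of_ne (h : IsTreeShape A T.shape) (hP : IsLeafParent A T.shape j P)
    (hP' : IsLeafParent A T.shape j' P') (hjj' : j ≠ j') (hne : P ≠ P') {i : ℕ}
    (hij : i ≠ j) (hij' : i ≠ j') :
    (proj j' (proj j T)).top i =
      if P'.erase j' = {i} ∨ (P'.erase j' = P ∧ P.erase j = {i}) then
        (if P.erase j = {i} then T.top i + T.top j + (T.part P).1 else T.top i) + T.top j' +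
          (if P' = P.erase j then (T.part P').1 + T.top j + (T.part P).1 else (T.part P').1)
      else if P.erase j = {i} then T.top i + T.top j + (T.part P).1 else T.top i := by
  have htop : (proj j T).top j' = T.top j' := by
    rw [proj_top h hP, if_neg hjj'.symm, if_neg]
    exact h.erase_ne_singleton hP' hP hjj' hne
  have hiff : (P'.erase j).erase j' = {i} ↔
      P'.erase j' = {i} ∨ (P'.erase j' = P ∧ P.erase j = {i}) := by
    by_cases hi : i ∈ A
    · have := erase_eq_erase_iff_of_ne h hP hP' hjj' hne (mem_edges.2 (Or.inr ⟨i, hi, rfl⟩))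
        (by simpa using hij) (h.ne_singleton hP.mem i).symm
      rw [Finset.erase_eq_of_notMem (by simpa using hij.symm)] at this
      simpa only [eq_comm (a := ({i} : Finset ℕ))] using this
    · have hsub : ∀ Q ∈ T.shape, i ∉ Q := fun Q hQ hiQ => hi (h.subset_ground Q hQ hiQ)
      have hmem : ∀ s : Finset ℕ, s = {i} → i ∈ s := by rintro s rfl; simp
      refine iff_of_false (fun he => ?_) ?_
      · exact hsub P' hP'.mem (Finset.mem_of_mem_erase (Finset.mem_of_mem_erase (hmem _ he)))
      · rintro (he | ⟨-, he⟩)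
        · exact hsub P' hP'.mem (Finset.mem_of_mem_erase (hmem _ he))
        · exact hsub P hP.mem (Finset.mem_of_mem_erase (hmem _ he))
  rw [proj_top (proj_isTreeShape h hP) (isLeafParent_proj_of_ne h hP hP' hjj' hne),
    if_neg hij', htop, proj_top h hP, if_neg hij, proj_part h hP hP'.mem hne.symm,
    apply_ite Prod.fst]
  simp only [hiff, IP.concat_fst, IP.single_fst]

theorem proj_proj_top_of_eq_or (h : IsTreeShape A T.shape) (hP : IsLeafParent A T.shape j P)
    {Q : Finset ℕ} (hP1 : IsLeafParent (A.erase j) (proj j T).shape j' Q)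
    {i : ℕ} (hi : i = j ∨ i = j') : (proj j' (proj j T)).top i = 0 := by
  have h1 := proj_isTreeShape h hP
  rw [proj_top h1 hP1]
  by_cases hij' : i = j'
  · rw [if_pos hij']
  · obtain rfl := hi.resolve_right hij'
    rw [if_neg hij', if_neg, proj_top h hP, if_pos rfl]
    intro he
    have := h1.edge_subset hP1.sibling_mem (he ▸ Finset.mem_singleton_self i)
    simp at this

theorem ATree.ext {T₁ T₂ : ATree} (hs : T₁.shape = T₂.shape) (ht : T₁.top = T₂.top)
    (hp : T₁.part = T₂.part) : T₁ = T₂ := by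
  cases T₁; cases T₂; simp_all

theorem proj_comm_of_ne (h : IsTreeShape A T.shape) (hP : IsLeafParent A T.shape j P)
    (hP' : IsLeafParent A T.shape j' P') (hjj' : j ≠ j') (hne : P ≠ P') :
    proj j (proj j' T) = proj j' (proj j T) := by
  have hP1 := isLeafParent_proj_of_ne h hP hP' hjj' hne
  have hP1' := isLeafParent_proj_of_ne h hP' hP hjj'.symm hne.symm
  have hs : (proj j (proj j' T)).shape = (proj j' (proj j T)).shape := by
    ext F
    rw [mem_proj_proj_shape h hP hP'.mem hne.symm hP1,
      mem_proj_proj_shape h hP' hP.mem hne hP1']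
    simp only [Finset.erase_right_comm (a := j') (b := j)]
    exact exists_congr fun E => by tauto
  have hx : P'.erase j' = P → P' ≠ P.erase j := by
    intro h1 h2
    have := hP.label_mem
    rw [← h1, h2] at this
    simp at this
  have hy : P.erase j ≠ P'.erase j' := by
    intro he
    have hlam := h.nested_or_disjoint P (mem_edges.2 (Or.inl hP.mem)) P'
      (mem_edges.2 (Or.inl hP'.mem))
    rcases hlam with h' | h' | h'
    · have : j ∈ P'.erase j' := Finset.mem_erase.2 ⟨hjj', h' hP.label_mem⟩
      rw [← he] at this
      simp at this
    · have : j' ∈ P.erase j := Finset.mem_erase.2 ⟨hjj'.symm, h' hP'.label_mem⟩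
      rw [he] at this
      simp at this
    · obtain ⟨x, hx⟩ := h.edge_nonempty hP.sibling_mem
      exact Finset.disjoint_left.1 h' (Finset.mem_of_mem_erase hx)
        (Finset.mem_of_mem_erase (he ▸ hx))
  refine ATree.ext hs ?_ ?_
  · funext i
    by_cases hi : i = j ∨ i = j'
    · rw [proj_proj_top_of_eq_or h hP hP1 hi, proj_proj_top_of_eq_or h hP' hP1' hi.symm]
    · obtain ⟨hij, hij'⟩ := not_or.1 hi
      rw [proj_proj_top_of_ne h hP hP' hjj' hne hij hij',
        proj_proj_top_of_ne h hP' hP hjj'.symm hne.symm hij' hij]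
      have h1 := h.ne_singleton hP.mem i
      have h2 := h.ne_singleton hP'.mem i
      generalize P.erase j = S at *
      generalize P'.erase j' = S' at *
      grind
  · funext F
    by_cases hF : F ∈ (proj j' (proj j T)).shape
    · obtain ⟨E, hE, hEP, hEP', rfl⟩ := (mem_proj_proj_shape h hP hP'.mem hne.symm hP1).1 hF
      rw [proj_proj_part_of_ne h hP hP' hjj' hne hE hEP hEP', Finset.erase_right_comm,
        proj_proj_part_of_ne h hP' hP hjj'.symm hne.symm hE hEP' hEP]
      generalize P.erase j = S at *
      generalize P'.erase j' = S' at *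
      grind [IP.concat_assoc]
    · rw [proj_part_of_notMem hF, proj_part_of_notMem (hs ▸ hF)]

end commutation

section cherry

variable {A P Q : Finset ℕ} {T : ATree} {j j' : ℕ}

theorem IsTreeShape.eq_pair (h : IsTreeShape A T.shape) (hP : IsLeafParent A T.shape j P)
    (hP' : IsLeafParent A T.shape j' P) (hjj' : j ≠ j') : P = {j, j'} := by
  rw [← Finset.insert_erase hP.label_mem, h.erase_eq_singleton hP hP' hjj'.symm]

theorem isLeafParent_proj_of_eq (h : IsTreeShape A T.shape)
    (hP : IsLeafParent A T.shape j P) (hP' : IsLeafParent A T.shape j' P) (hjj' : j ≠ j')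
    (hQ : Q ∈ T.shape) (hPQ : P ⊂ Q) (hR : Q \ P ∈ edges A T.shape) :
    IsLeafParent (A.erase j) (proj j T).shape j' (Q.erase j) := by
  rw [proj_shape h hP]
  refine h.isLeafParent_eraseShape hP hQ hPQ.ne' (hPQ.subset hP'.label_mem) hjj'.symm
    ⟨Q \ P, hR, ?_, ?_⟩
  · intro he
    have : j ∈ Q \ P := he ▸ Finset.mem_singleton_self j
    exact (Finset.mem_sdiff.1 this).2 hP.label_mem
  · rw [h.eq_pair hP hP' hjj']
    ext x
    simp only [Finset.mem_erase, Finset.mem_sdiff, Finset.mem_insert, Finset.mem_singleton]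
    tauto

theorem erase_erase_eq_sdiff (h : IsTreeShape A T.shape)
    (hP : IsLeafParent A T.shape j P) (hP' : IsLeafParent A T.shape j' P) (hjj' : j ≠ j') :
    (Q.erase j).erase j' = Q \ P := by
  rw [h.eq_pair hP hP' hjj']
  ext x
  simp only [Finset.mem_erase, Finset.mem_sdiff, Finset.mem_insert, Finset.mem_singleton]
  tauto

theorem proj_top_of_eq (h : IsTreeShape A T.shape)
    (hP : IsLeafParent A T.shape j P) (hP' : IsLeafParent A T.shape j' P) (hjj' : j ≠ j') :
    (proj j T).top j' = T.top j' + T.top j + (T.part P).1 := by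
  rw [proj_top h hP, if_neg hjj'.symm, if_pos (h.erase_eq_singleton hP hP' hjj'.symm)]

theorem proj_part_of_eq (h : IsTreeShape A T.shape)
    (hP : IsLeafParent A T.shape j P) (hP' : IsLeafParent A T.shape j' P) (hjj' : j ≠ j')
    {E : Finset ℕ} (hE : E ∈ T.shape) (hEP : E ≠ P) :
    (proj j T).part (E.erase j) = T.part E := by
  rw [proj_part h hP hE hEP, if_neg]
  rw [h.erase_eq_singleton hP hP' hjj'.symm]
  exact h.ne_singleton hE j'

theorem proj_proj_part_of_eq (h : IsTreeShape A T.shape)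
    (hP : IsLeafParent A T.shape j P) (hP' : IsLeafParent A T.shape j' P) (hjj' : j ≠ j')
    (hQ : Q ∈ T.shape) (hPQ : P ⊂ Q) (hR : Q \ P ∈ edges A T.shape)
    {E : Finset ℕ} (hE : E ∈ T.shape) (hEP : E ≠ P) (hEQ : E ≠ Q) :
    (proj j' (proj j T)).part ((E.erase j).erase j') = if E = Q \ P then
      ((T.part E).concat (IP.single (T.top j' + T.top j + (T.part P).1))).concat (T.part Q)
      else T.part E := by
  have hjR : j ∉ Q \ P := fun hj => (Finset.mem_sdiff.1 hj).2 hP.label_mem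
  have hiff : E.erase j = Q \ P ↔ E = Q \ P := by
    constructor
    · intro he
      rcases h.erase_inj hP (mem_edges.2 (Or.inl hE)) hR (h.ne_singleton hE j)
        (fun h' => hjR (h' ▸ Finset.mem_singleton_self j))
        (by rw [he, Finset.erase_eq_of_notMem hjR]) with h' | h' | h'
      · exact h'
      · exact absurd h'.1 hEP
      · rw [h'.1] at hjR
        exact absurd hP.label_mem hjR
    · intro he
      rw [he, Finset.erase_eq_of_notMem hjR]
  rw [proj_part (proj_isTreeShape h hP) (isLeafParent_proj_of_eq h hP hP' hjj' hQ hPQ hR)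
    (mem_proj_shape h hP hE hEP) (erase_ne_erase h hP hE hQ hEP hPQ.ne' hEQ),
    proj_part_of_eq h hP hP' hjj' hE hEP, proj_part_of_eq h hP hP' hjj' hQ hPQ.ne',
    proj_top_of_eq h hP hP' hjj', erase_erase_eq_sdiff h hP hP' hjj']
  simp only [hiff]

theorem proj_proj_top_of_eq (h : IsTreeShape A T.shape)
    (hP : IsLeafParent A T.shape j P) (hP' : IsLeafParent A T.shape j' P) (hjj' : j ≠ j')
    (hQ : Q ∈ T.shape) (hPQ : P ⊂ Q) (hR : Q \ P ∈ edges A T.shape) {i : ℕ}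
    (hij : i ≠ j) (hij' : i ≠ j') :
    (proj j' (proj j T)).top i = if Q \ P = {i} then
      T.top i + (T.top j' + T.top j + (T.part P).1) + (T.part Q).1 else T.top i := by
  rw [proj_top (proj_isTreeShape h hP) (isLeafParent_proj_of_eq h hP hP' hjj' hQ hPQ hR),
    if_neg hij', erase_erase_eq_sdiff h hP hP' hjj', proj_top_of_eq h hP hP' hjj',
    proj_part_of_eq h hP hP' hjj' hQ hPQ.ne', proj_top h hP, if_neg hij,
    h.erase_eq_singleton hP hP' hjj'.symm,
    if_neg (show ({j'} : Finset ℕ) ≠ {i} by simpa using hij'.symm)]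

theorem proj_comm_of_eq (hA : 3 ≤ A.card) (h : IsTreeShape A T.shape)
    (hP : IsLeafParent A T.shape j P) (hP' : IsLeafParent A T.shape j' P) (hjj' : j ≠ j') :
    proj j (proj j' T) = proj j' (proj j T) := by
  obtain ⟨Q, hQ, hPQ, hR⟩ := h.exists_parent (mem_edges.2 (Or.inl hP.mem)) (by
    rintro rfl
    rw [h.eq_pair hP hP' hjj', Finset.card_pair hjj'] at hA
    omega)
  have hP1 := isLeafParent_proj_of_eq h hP hP' hjj' hQ hPQ hR
  have hP1' := isLeafParent_proj_of_eq h hP' hP hjj'.symm hQ hPQ hR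
  have hs : (proj j (proj j' T)).shape = (proj j' (proj j T)).shape := by
    ext F
    rw [mem_proj_proj_shape h hP hQ hPQ.ne' hP1, mem_proj_proj_shape h hP' hQ hPQ.ne' hP1']
    simp only [Finset.erase_right_comm (a := j') (b := j)]
  refine ATree.ext hs ?_ ?_
  · funext i
    by_cases hi : i = j ∨ i = j'
    · rw [proj_proj_top_of_eq_or h hP hP1 hi, proj_proj_top_of_eq_or h hP' hP1' hi.symm]
    · obtain ⟨hij, hij'⟩ := not_or.1 hi
      rw [proj_proj_top_of_eq h hP hP' hjj' hQ hPQ hR hij hij',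
        proj_proj_top_of_eq h hP' hP hjj'.symm hQ hPQ hR hij' hij,
        add_comm (T.top j) (T.top j')]
  · funext F
    by_cases hF : F ∈ (proj j' (proj j T)).shape
    · obtain ⟨E, hE, hEP, hEQ, rfl⟩ := (mem_proj_proj_shape h hP hQ hPQ.ne' hP1).1 hF
      rw [proj_proj_part_of_eq h hP hP' hjj' hQ hPQ hR hE hEP hEQ, Finset.erase_right_comm,
        proj_proj_part_of_eq h hP' hP hjj'.symm hQ hPQ hR hE hEP hEQ,
        add_comm (T.top j) (T.top j')]
    · rw [proj_part_of_notMem hF, proj_part_of_notMem (hs ▸ hF)]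

end cherry

/-- **Projections of A-trees commute.**  For distinct labels `j, j'` of an `A`-tree
`T ∈ 𝕋_A` with `#A ≥ 3`, the projection `π_{−j}` maps `𝕋_A` into `𝕋_{A∖{j}}`, and
`π_{−j}(π_{−j'}(T)) = π_{−j'}(π_{−j}(T))`. -/
theorem proj_mem_and_proj_comm (A : Finset ℕ) (hA : 3 ≤ A.card)
    (j j' : ℕ) (hj : j ∈ A) (hj' : j' ∈ A) (hjj' : j ≠ j')
    (T : ATree) (hT : MemT A T) :
    MemT (A.erase j) (proj j T) ∧
    proj j (proj j' T) = proj j' (proj j T) := by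
  have h := hT.1.1
  obtain ⟨P, hP⟩ := h.exists_isLeafParent (by omega) hj
  obtain ⟨P', hP'⟩ := h.exists_isLeafParent (by omega) hj'
  refine ⟨hT.proj (by omega) hj, ?_⟩
  by_cases hne : P = P'
  · subst hne
    exact proj_comm_of_eq hA h hP hP' hjj'
  · exact proj_comm_of_ne h hP hP' hjj' hne

end AldousTrees
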